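/- The D^(1)_n tropical R commutes with the involutions σ_1, σ_n and σ✶: for every admissible pair (x,y) ∈ B×B such that σ_a(x,y) is also admissible, one has R(σ_a(x,y)) = σ_a(R(x,y)) for each a ∈ {1, n, ✶}. -/

import Mathlib

/-- The level `ℓ(x)` of an element of `B`, represented by the pair of families
`x = (x_1,…,x_n)` and `xb = (x̄_1,…,x̄_{n-1})`. -/
def lev {F : Type*} [Field F] (n : ℕ) (x xb : ℕ → F) : F :=
  (∏ i ∈ Finset.Icc 1 n, x i) * ∏ i ∈ Finset.Icc 1 (n - 1), xb i

/-- The functions `V_0, V_1, …, V_{n-1}` of the `D^(1)_n` tropical `R`. -/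
def Vf {F : Type*} [Field F] (n : ℕ) (x xb y yb : ℕ → F) : ℕ → F
  | 0 =>
      lev n x xb * (y 1 / yb 1)
      + lev n x xb *
          ∑ m ∈ Finset.Icc 2 (n - 1), (∏ i ∈ Finset.Icc 1 (m - 1), y i / x i) * (1 + y m / yb m)
      + x n * y n * ∏ i ∈ Finset.Icc 1 (n - 1), xb i * y i
      + lev n y yb * (xb 1 / x 1)
      + lev n y yb *
          ∑ m ∈ Finset.Icc 2 (n - 1), (∏ i ∈ Finset.Icc 1 (m - 1), xb i / yb i) * (1 + xb m / x m)
      + ∏ i ∈ Finset.Icc 1 (n - 1), xb i * y i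
  | (i + 1) =>
      if i + 1 = n - 1 then
        (yb (i + 1) / y n) * (y n * Vf n x xb y yb i / xb (i + 1)
          + (lev n x xb - lev n y yb) * (y n / x (i + 1) + 1 / yb (i + 1)))
      else
        yb (i + 1) * (Vf n x xb y yb i / xb (i + 1)
          + (lev n x xb - lev n y yb) * (1 / x (i + 1) + 1 / yb (i + 1)))

/-- `σ_1` (first component): swap the indices `1` of the two families. -/
def sw1 {F : Type*} (x xb : ℕ → F) : ℕ → F := fun i => if i = 1 then xb 1 else x i

/-- `σ_n` on the unbarred family. -/
def snx {F : Type*} [Field F] (n : ℕ) (x : ℕ → F) : ℕ → F :=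
  fun i => if i = n - 1 then x (n - 1) * x n else if i = n then (x n)⁻¹ else x i

/-- `σ_n` on the barred family. -/
def snxb {F : Type*} [Field F] (n : ℕ) (x xb : ℕ → F) : ℕ → F :=
  fun i => if i = n - 1 then xb (n - 1) * x n else xb i

/-- `σ✶` (unbarred part of the first component of `σ✶(x,y)`, built from `y`). -/
def stx {F : Type*} (n : ℕ) (y yb : ℕ → F) : ℕ → F := fun i => if i = n then y n else yb i

/-- `V_i^{σ_1}`. -/
def Vs1 {F : Type*} [Field F] (n : ℕ) (x xb y yb : ℕ → F) : ℕ → F :=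
  Vf n (sw1 x xb) (sw1 xb x) (sw1 y yb) (sw1 yb y)

/-- `V_i^{σ_n}`. -/
def Vsn {F : Type*} [Field F] (n : ℕ) (x xb y yb : ℕ → F) : ℕ → F :=
  Vf n (snx n x) (snxb n x xb) (snx n y) (snxb n y yb)

/-- `V_i^{σ✶}`. -/
def Vst {F : Type*} [Field F] (n : ℕ) (x xb y yb : ℕ → F) : ℕ → F :=
  Vf n (stx n y yb) y (stx n x xb) x

/-- The functions `U_1, …, U_{n-1}` of the `D^(1)_n` tropical `R`. -/
def Uf {F : Type*} [Field F] (n : ℕ) (x xb y yb : ℕ → F) : ℕ → F := fun i =>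
  if i = 1 then Vf n x xb y yb 0 * Vs1 n x xb y yb 0
  else if i = n - 1 then Vf n x xb y yb (n - 1) * Vst n x xb y yb (n - 1)
  else (1 / x i + 1 / yb i)⁻¹ *
    (Vf n x xb y yb i * Vst n x xb y yb (i - 1) / y i
      + Vf n x xb y yb (i - 1) * Vst n x xb y yb i / xb i)

/-- unbarred part `x'` of the output of the tropical `R`. -/
def Rx {F : Type*} [Field F] (n : ℕ) (x xb y yb : ℕ → F) : ℕ → F := fun i =>
  if i = 1 then y 1 * Vs1 n x xb y yb 0 / Vf n x xb y yb 1
  else if i = n then y n * Vf n x xb y yb (n - 1) / Vsn n x xb y yb (n - 1)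
  else y i * Vf n x xb y yb (i - 1) * Uf n x xb y yb i
        / (Vf n x xb y yb i * Uf n x xb y yb (i - 1))

/-- barred part `x̄'` of the output of the tropical `R`. -/
def Rxb {F : Type*} [Field F] (n : ℕ) (x xb y yb : ℕ → F) : ℕ → F := fun i =>
  if i = 1 then yb 1 * Vf n x xb y yb 0 / Vf n x xb y yb 1
  else yb i * Vf n x xb y yb (i - 1) / Vf n x xb y yb i

/-- unbarred part `y'` of the output of the tropical `R`. -/
def Ry {F : Type*} [Field F] (n : ℕ) (x xb y yb : ℕ → F) : ℕ → F := fun i =>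
  if i = 1 then x 1 * Vf n x xb y yb 0 / Vst n x xb y yb 1
  else if i = n then x n * Vsn n x xb y yb (n - 1) / Vf n x xb y yb (n - 1)
  else x i * Vst n x xb y yb (i - 1) / Vst n x xb y yb i

/-- barred part `ȳ'` of the output of the tropical `R`. -/
def Ryb {F : Type*} [Field F] (n : ℕ) (x xb y yb : ℕ → F) : ℕ → F := fun i =>
  if i = 1 then xb 1 * Vs1 n x xb y yb 0 / Vst n x xb y yb 1
  else xb i * Vst n x xb y yb (i - 1) * Uf n x xb y yb i
        / (Vst n x xb y yb i * Uf n x xb y yb (i - 1))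

/-- Admissibility: all the quantities `V_i`, `U_i` and their `σ`-transforms appearing in
the formulas of the tropical `R` are nonzero. -/
def Adm {F : Type*} [Field F] (n : ℕ) (x xb y yb : ℕ → F) : Prop :=
  (∀ i ≤ n - 1, Vf n x xb y yb i ≠ 0) ∧
  (∀ i ≤ n - 1, Vst n x xb y yb i ≠ 0) ∧
  Vs1 n x xb y yb 0 ≠ 0 ∧
  Vsn n x xb y yb (n - 1) ≠ 0 ∧
  (∀ i, 1 ≤ i → i ≤ n - 1 → Uf n x xb y yb i ≠ 0)

/-- The unbarred part of `[μ; τ, C, τ']`. -/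
def brkX {F : Type*} [Field F] (n : ℕ) (μ τ C τ' : ℕ → F) : ℕ → F := fun i =>
  if i = 1 then (μ 1)⁻¹ * (τ 0 * τ' 1 / C 1)
  else if i = 2 then (μ 2)⁻¹ * (C 1 * τ' 2 / (C 2 * τ' 0 * τ' 1))
  else if i = n - 1 then (μ (n - 1))⁻¹ * (C (n - 2) * τ' (n - 1) / (τ (n - 1) * τ' (n - 2)))
  else if i = n then (μ n)⁻¹ * (τ (n - 1) * τ' n / (τ n * τ' (n - 1)))
  else (μ i)⁻¹ * (C (i - 1) * τ' i / (C i * τ' (i - 1)))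

/-- The barred part of `[μ; τ, C, τ']` (here `μb` is the barred part of `μ`). -/
def brkXb {F : Type*} [Field F] (n : ℕ) (μb τ C τ' : ℕ → F) : ℕ → F := fun i =>
  if i = 1 then (μb 1)⁻¹ * (τ 1 * τ' 0 / C 1)
  else if i = 2 then (μb 2)⁻¹ * (C 1 * τ 2 / (C 2 * τ 0 * τ 1))
  else if i = n - 1 then (μb (n - 1))⁻¹ * (C (n - 2) * τ n / (τ (n - 2) * τ' n))
  else (μb i)⁻¹ * (C (i - 1) * τ i / (C i * τ (i - 1)))

section TropicalR

variable {F : Type*} [Field F]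

/-- The data of a point of `B × B`: all the relevant coordinates are nonzero. -/
structure CoordNeZero (n : ℕ) (x xb y yb : ℕ → F) : Prop where
  x_ne : ∀ i, 1 ≤ i → i ≤ n → x i ≠ 0
  xb_ne : ∀ i, 1 ≤ i → i ≤ n - 1 → xb i ≠ 0
  y_ne : ∀ i, 1 ≤ i → i ≤ n → y i ≠ 0
  yb_ne : ∀ i, 1 ≤ i → i ≤ n - 1 → yb i ≠ 0

theorem CoordNeZero.star {n : ℕ} (hn : 4 ≤ n) {x xb y yb : ℕ → F}
    (h : CoordNeZero n x xb y yb) :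
    CoordNeZero n (stx n y yb) y (stx n x xb) x where
  x_ne i h1 h2 := by
    by_cases hi : i = n
    · simpa [stx, hi] using h.y_ne n (by omega) le_rfl
    · simpa [stx, hi] using h.yb_ne i h1 (by omega)
  xb_ne i h1 h2 := h.y_ne i h1 (by omega)
  y_ne i h1 h2 := by
    by_cases hi : i = n
    · simpa [stx, hi] using h.x_ne n (by omega) le_rfl
    · simpa [stx, hi] using h.xb_ne i h1 (by omega)
  yb_ne i h1 h2 := h.x_ne i h1 (by omega)

/-- The sums occurring in `V_0`. -/
def stepSum (a b c : ℕ → F) (k : ℕ) : F :=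
  a 1 / c 1 + ∑ m ∈ Finset.Icc 2 k, (∏ i ∈ Finset.Icc 1 (m - 1), a i / b i) * (1 + a m / c m)

theorem stepSum_one (a b c : ℕ → F) : stepSum a b c 1 = a 1 / c 1 := by
  simp [stepSum]

theorem stepSum_succ (a b c : ℕ → F) {k : ℕ} (hk : 1 ≤ k) :
    stepSum a b c (k + 1) = stepSum a b c k
      + (∏ i ∈ Finset.Icc 1 k, a i / b i) * (1 + a (k + 1) / c (k + 1)) := by
  rw [stepSum, stepSum, Finset.sum_Icc_succ_top (by omega), Nat.add_sub_cancel, add_assoc]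

theorem stepSum_congr {a b c a' b' c' : ℕ → F} {k : ℕ} (hk : 1 ≤ k)
    (ha : ∀ i, 1 ≤ i → i ≤ k → a i = a' i) (hb : ∀ i, 1 ≤ i → i ≤ k → b i = b' i)
    (hc : ∀ i, 1 ≤ i → i ≤ k → c i = c' i) : stepSum a b c k = stepSum a' b' c' k := by
  unfold stepSum
  rw [ha 1 le_rfl hk, hc 1 le_rfl hk]
  congr 1
  refine Finset.sum_congr rfl fun m hm => ?_
  rw [Finset.mem_Icc] at hm
  rw [ha m (by omega) hm.2, hc m (by omega) hm.2]
  congr 1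
  refine Finset.prod_congr rfl fun i hi => ?_
  rw [Finset.mem_Icc] at hi
  rw [ha i hi.1 (by omega), hb i hi.1 (by omega)]

theorem prod_Icc_one_eq_mul {f : ℕ → F} {k : ℕ} (hk : 1 ≤ k) :
    ∏ i ∈ Finset.Icc 1 k, f i = f 1 * ∏ i ∈ Finset.Ioc 1 k, f i :=
  (Finset.mul_prod_Ioc_eq_prod_Icc hk).symm

theorem prod_Icc_ne_zero {f : ℕ → F} {k : ℕ} (hf : ∀ i, 1 ≤ i → i ≤ k → f i ≠ 0) :
    ∏ i ∈ Finset.Icc 1 k, f i ≠ 0 :=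
  Finset.prod_ne_zero_iff.2 fun i hi => hf i (Finset.mem_Icc.1 hi).1 (Finset.mem_Icc.1 hi).2

/-- `stepSum` as an affine function of the entries of index one. -/
theorem stepSum_eq_add_mul (a b c : ℕ → F) (k : ℕ) :
    stepSum a b c k = a 1 / c 1 + a 1 / b 1 *
      ∑ m ∈ Finset.Icc 2 k, (∏ i ∈ Finset.Ioc 1 (m - 1), a i / b i) * (1 + a m / c m) := by
  unfold stepSum
  rw [Finset.mul_sum]
  congr 1
  refine Finset.sum_congr rfl fun m hm => ?_
  rw [Finset.mem_Icc] at hm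
  rw [prod_Icc_one_eq_mul (by omega), mul_assoc]

theorem Vf_zero (n : ℕ) (x xb y yb : ℕ → F) :
    Vf n x xb y yb 0 = lev n x xb * stepSum y x yb (n - 1)
      + lev n y yb * stepSum xb yb x (n - 1)
      + (x n * y n + 1) * ∏ i ∈ Finset.Icc 1 (n - 1), xb i * y i := by
  simp only [Vf, stepSum]
  ring

theorem Vf_succ (n : ℕ) (x xb y yb : ℕ → F) {i : ℕ} (hi : i + 1 ≠ n - 1) :
    Vf n x xb y yb (i + 1) = yb (i + 1) * (Vf n x xb y yb i / xb (i + 1)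
          + (lev n x xb - lev n y yb) * (1 / x (i + 1) + 1 / yb (i + 1))) := by
  rw [Vf, if_neg hi]

theorem Vf_last (n : ℕ) (x xb y yb : ℕ → F) {i : ℕ} (hi : i + 1 = n - 1) :
    Vf n x xb y yb (i + 1) = (yb (i + 1) / y n) * (y n * Vf n x xb y yb i / xb (i + 1)
          + (lev n x xb - lev n y yb) * (y n / x (i + 1) + 1 / yb (i + 1))) := by
  rw [Vf, if_pos hi]

theorem lev_congr {n : ℕ} {x xb xb' : ℕ → F}
    (h : ∀ i, 1 ≤ i → i ≤ n - 1 → xb i = xb' i) : lev n x xb = lev n x xb' := by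
  unfold lev
  congr 1
  refine Finset.prod_congr rfl fun i hi => ?_
  rw [Finset.mem_Icc] at hi
  exact h i hi.1 hi.2

/-- `V_i` only depends on the entries of the barred families with index in `[1, n - 1]`. -/
theorem Vf_congr {n : ℕ} (hn : 4 ≤ n) {x xb y yb xb' yb' : ℕ → F}
    (h : ∀ i, 1 ≤ i → i ≤ n - 1 → xb i = xb' i) (h' : ∀ i, 1 ≤ i → i ≤ n - 1 → yb i = yb' i)
    {i : ℕ} (hi : i ≤ n - 1) : Vf n x xb y yb i = Vf n x xb' y yb' i := by
  have hl : lev n x xb = lev n x xb' := lev_congr h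
  have hl' : lev n y yb = lev n y yb' := lev_congr h'
  induction i with
  | zero =>
    rw [Vf_zero, Vf_zero, hl, hl',
      stepSum_congr (a := xb) (b := yb) (c := x) (by omega) h h' fun _ _ _ => rfl,
      stepSum_congr (a := y) (b := x) (c := yb) (by omega) (fun _ _ _ => rfl)
        (fun _ _ _ => rfl) h']
    congr 2
    refine Finset.prod_congr rfl fun i hi => ?_
    rw [Finset.mem_Icc] at hi
    rw [h i hi.1 hi.2]
  | succ i ih =>
    have ih := ih (by omega)
    by_cases hin : i + 1 = n - 1
    · rw [Vf_last n _ _ _ _ hin, Vf_last n _ _ _ _ hin, ih, hl, hl', h _ (by omega) hi,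
        h' _ (by omega) hi]
    · rw [Vf_succ n _ _ _ _ hin, Vf_succ n _ _ _ _ hin, ih, hl, hl', h _ (by omega) hi,
        h' _ (by omega) hi]

/-! ### Invariance of the level -/

theorem lev_sw1 {n : ℕ} (hn : 4 ≤ n) (x xb : ℕ → F) :
    lev n (sw1 x xb) (sw1 xb x) = lev n x xb := by
  have key : ∀ (f g : ℕ → F) (k : ℕ),
      ∏ i ∈ Finset.Ioc 1 k, sw1 f g i = ∏ i ∈ Finset.Ioc 1 k, f i := fun f g k => by
    refine Finset.prod_congr rfl fun i hi => ?_
    rw [Finset.mem_Ioc] at hi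
    exact if_neg (by omega)
  have h1 : 1 ≤ n := by omega
  have h2 : 1 ≤ n - 1 := by omega
  unfold lev
  rw [prod_Icc_one_eq_mul h1, prod_Icc_one_eq_mul h2, prod_Icc_one_eq_mul h1,
    prod_Icc_one_eq_mul h2, key, key]
  simp only [sw1, if_true]
  ring

theorem prod_stx {n : ℕ} (hn : 4 ≤ n) (x xb : ℕ → F) :
    ∏ i ∈ Finset.Icc 1 n, stx n x xb i = (∏ i ∈ Finset.Icc 1 (n - 1), xb i) * x n := by
  obtain ⟨k, rfl⟩ : ∃ k, n = k + 1 := ⟨n - 1, by omega⟩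
  rw [Finset.prod_Icc_succ_top (by omega), Nat.add_sub_cancel]
  congr 1
  · refine Finset.prod_congr rfl fun i hi => ?_
    rw [Finset.mem_Icc] at hi
    exact if_neg (by omega)
  · exact if_pos rfl

theorem lev_eq {n : ℕ} (hn : 4 ≤ n) (x xb : ℕ → F) :
    lev n x xb
      = x n * (∏ i ∈ Finset.Icc 1 (n - 1), x i) * ∏ i ∈ Finset.Icc 1 (n - 1), xb i := by
  obtain ⟨k, rfl⟩ : ∃ k, n = k + 1 := ⟨n - 1, by omega⟩
  rw [lev, Finset.prod_Icc_succ_top (by omega), Nat.add_sub_cancel]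
  ring

theorem lev_stx {n : ℕ} (hn : 4 ≤ n) (x xb : ℕ → F) :
    lev n (stx n x xb) x = lev n x xb := by
  rw [lev, prod_stx hn, lev_eq hn]
  ring

theorem snx_of_lt {n i : ℕ} (x : ℕ → F) (hi : i < n - 1) : snx n x i = x i := by
  rw [snx, if_neg (by omega), if_neg (by omega)]

theorem snxb_of_lt {n i : ℕ} (x xb : ℕ → F) (hi : i < n - 1) : snxb n x xb i = xb i := by
  rw [snxb, if_neg (by omega)]

theorem snx_pred (n : ℕ) (x : ℕ → F) : snx n x (n - 1) = x (n - 1) * x n := by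
  simp [snx]

theorem snxb_pred (n : ℕ) (x xb : ℕ → F) : snxb n x xb (n - 1) = xb (n - 1) * x n := by
  simp [snxb]

theorem snx_self {n : ℕ} (hn : 4 ≤ n) (x : ℕ → F) : snx n x n = (x n)⁻¹ := by
  rw [snx, if_neg (by omega), if_pos rfl]

theorem prod_pred_eq_mul {n : ℕ} (hn : 4 ≤ n) (f : ℕ → F) :
    ∏ i ∈ Finset.Icc 1 (n - 1), f i = (∏ i ∈ Finset.Icc 1 (n - 2), f i) * f (n - 1) := by
  obtain ⟨k, rfl⟩ : ∃ k, n = k + 2 := ⟨n - 2, by omega⟩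
  exact Finset.prod_Icc_succ_top (by omega) _

theorem prod_snx {n : ℕ} (hn : 4 ≤ n) (x : ℕ → F) :
    ∏ i ∈ Finset.Icc 1 (n - 1), snx n x i = (∏ i ∈ Finset.Icc 1 (n - 1), x i) * x n := by
  rw [prod_pred_eq_mul hn, prod_pred_eq_mul hn, snx_pred, ← mul_assoc]
  congr 2
  refine Finset.prod_congr rfl fun i hi => ?_
  rw [Finset.mem_Icc] at hi
  exact snx_of_lt x (by omega)

theorem prod_snxb {n : ℕ} (hn : 4 ≤ n) (x xb : ℕ → F) :
    ∏ i ∈ Finset.Icc 1 (n - 1), snxb n x xb i = (∏ i ∈ Finset.Icc 1 (n - 1), xb i) * x n := by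
  rw [prod_pred_eq_mul hn, prod_pred_eq_mul hn, snxb_pred, ← mul_assoc]
  congr 2
  refine Finset.prod_congr rfl fun i hi => ?_
  rw [Finset.mem_Icc] at hi
  exact snxb_of_lt x xb (by omega)

theorem lev_snx {n : ℕ} (hn : 4 ≤ n) (x xb : ℕ → F) (hx : x n ≠ 0) :
    lev n (snx n x) (snxb n x xb) = lev n x xb := by
  rw [lev_eq hn, lev_eq hn, prod_snx hn, prod_snxb hn, snx_self hn]
  field_simp

/-! ### Transforms of the functions `V_i` -/

/-- `V_0` is invariant under `σ✶`. -/
theorem Vst_zero {n : ℕ} (hn : 4 ≤ n) (x xb y yb : ℕ → F) :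
    Vst n x xb y yb 0 = Vf n x xb y yb 0 := by
  have hs : ∀ (f g : ℕ → F) i, 1 ≤ i → i ≤ n - 1 → stx n f g i = g i := fun f g i _ hi =>
    if_neg (by omega)
  rw [Vst, Vf_zero, Vf_zero, lev_stx hn, lev_stx hn,
    stepSum_congr (a := stx n x xb) (by omega) (hs _ _) (hs _ _) (fun _ _ _ => rfl),
    stepSum_congr (c := stx n y yb) (by omega) (fun _ _ _ => rfl) (fun _ _ _ => rfl) (hs _ _)]
  have hp : ∏ i ∈ Finset.Icc 1 (n - 1), y i * stx n x xb i
      = ∏ i ∈ Finset.Icc 1 (n - 1), xb i * y i := by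
    refine Finset.prod_congr rfl fun i hi => ?_
    rw [Finset.mem_Icc] at hi
    rw [hs _ _ i hi.1 hi.2, mul_comm]
  rw [hp]
  simp only [stx, if_true]
  ring

theorem stepSum_snx {n : ℕ} (hn : 4 ≤ n) {a b c a' b' c' : ℕ → F} {t : F} (ht : t ≠ 0)
    (ha : ∀ i < n - 1, a' i = a i) (hb : ∀ i < n - 1, b' i = b i) (hc : ∀ i < n - 1, c' i = c i)
    (ha' : a' (n - 1) = a (n - 1) * t) (hc' : c' (n - 1) = c (n - 1) * t) :
    stepSum a' b' c' (n - 1) = stepSum a b c (n - 1) := by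
  obtain ⟨k, rfl⟩ : ∃ k, n = k + 2 := ⟨n - 2, by omega⟩
  have hk : k + 2 - 1 = k + 1 := rfl
  rw [hk] at ha' hc' ⊢
  rw [stepSum_succ _ _ _ (by omega), stepSum_succ _ _ _ (by omega), ha', hc',
    mul_div_mul_right _ _ ht,
    stepSum_congr (by omega) (fun i _ hi => ha i (by omega)) (fun i _ hi => hb i (by omega))
      (fun i _ hi => hc i (by omega))]
  congr 2
  refine Finset.prod_congr rfl fun i hi => ?_
  rw [Finset.mem_Icc] at hi
  rw [ha i (by omega), hb i (by omega)]

theorem stepSum_snx_left {n : ℕ} (hn : 4 ≤ n) (x y yb : ℕ → F) (hy : y n ≠ 0) :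
    stepSum (snx n y) (snx n x) (snxb n y yb) (n - 1) = stepSum y x yb (n - 1) :=
  stepSum_snx hn hy (fun _ => snx_of_lt _) (fun _ => snx_of_lt _) (fun _ => snxb_of_lt _ _)
    (snx_pred _ _) (snxb_pred _ _ _)

theorem stepSum_snx_right {n : ℕ} (hn : 4 ≤ n) (x xb y yb : ℕ → F) (hx : x n ≠ 0) :
    stepSum (snxb n x xb) (snxb n y yb) (snx n x) (n - 1) = stepSum xb yb x (n - 1) :=
  stepSum_snx hn hx (fun _ => snxb_of_lt _ _) (fun _ => snxb_of_lt _ _) (fun _ => snx_of_lt _)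
    (snxb_pred _ _ _) (snx_pred _ _)

/-- `V_i` is invariant under `σ_n` for `i ≤ n - 2`. -/
theorem Vsn_of_lt {n : ℕ} (hn : 4 ≤ n) (x xb y yb : ℕ → F) (hx : x n ≠ 0) (hy : y n ≠ 0)
    {i : ℕ} (hi : i < n - 1) : Vsn n x xb y yb i = Vf n x xb y yb i := by
  unfold Vsn
  induction i with
  | zero =>
    rw [Vf_zero, Vf_zero, lev_snx hn x xb hx, lev_snx hn y yb hy, stepSum_snx_left hn _ _ _ hy,
      stepSum_snx_right hn _ _ _ _ hx, snx_self hn, snx_self hn, Finset.prod_mul_distrib,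
      Finset.prod_mul_distrib, prod_snx hn, prod_snxb hn]
    field_simp
    ring
  | succ i ih =>
    rw [Vf_succ n _ _ _ _ (by omega), Vf_succ n _ _ _ _ (by omega), ih (by omega),
      lev_snx hn x xb hx, lev_snx hn y yb hy, snx_of_lt _ hi, snxb_of_lt _ _ hi,
      snxb_of_lt _ _ hi]

theorem stepSum_tail_sw1 (a a' b b' c c' : ℕ → F) (k : ℕ) :
    ∑ m ∈ Finset.Icc 2 k, (∏ i ∈ Finset.Ioc 1 (m - 1), sw1 a a' i / sw1 b b' i)
        * (1 + sw1 a a' m / sw1 c c' m)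
      = ∑ m ∈ Finset.Icc 2 k, (∏ i ∈ Finset.Ioc 1 (m - 1), a i / b i) * (1 + a m / c m) := by
  have hs : ∀ (f g : ℕ → F) i, 1 < i → sw1 f g i = f i := fun f g i hi => if_neg (by omega)
  refine Finset.sum_congr rfl fun m hm => ?_
  rw [Finset.mem_Icc] at hm
  rw [hs _ _ m (by omega), hs _ _ m (by omega)]
  congr 1
  refine Finset.prod_congr rfl fun i hi => ?_
  rw [Finset.mem_Ioc] at hi
  rw [hs _ _ i hi.1, hs _ _ i hi.1]

/-- `V_i` is invariant under `σ_1` for `i ≥ 1`. -/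
theorem Vs1_of_pos {n : ℕ} (hn : 4 ≤ n) (x xb y yb : ℕ → F) (hx : x 1 ≠ 0) (hxb : xb 1 ≠ 0)
    (hy : y 1 ≠ 0) (hyb : yb 1 ≠ 0) {i : ℕ} (hi : 1 ≤ i) :
    Vs1 n x xb y yb i = Vf n x xb y yb i := by
  have hs : ∀ (f g : ℕ → F) i, 1 < i → sw1 f g i = f i := fun f g i hi => if_neg (by omega)
  have hs1 : ∀ (f g : ℕ → F), sw1 f g 1 = g 1 := fun f g => if_pos rfl
  unfold Vs1
  induction i, hi using Nat.le_induction with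
  | base =>
    have hp : ∏ i ∈ Finset.Ioc 1 (n - 1), sw1 xb x i * sw1 y yb i
        = ∏ i ∈ Finset.Ioc 1 (n - 1), xb i * y i := by
      refine Finset.prod_congr rfl fun i hi => ?_
      rw [Finset.mem_Ioc] at hi
      rw [hs _ _ i hi.1, hs _ _ i hi.1]
    rw [Vf_succ n _ _ _ _ (by omega), Vf_succ n _ _ _ _ (by omega), Vf_zero, Vf_zero,
      lev_sw1 hn, lev_sw1 hn, stepSum_eq_add_mul, stepSum_eq_add_mul, stepSum_tail_sw1,
      stepSum_tail_sw1, stepSum_eq_add_mul y, stepSum_eq_add_mul xb,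
      prod_Icc_one_eq_mul (by omega), prod_Icc_one_eq_mul (by omega), hp, hs _ _ n (by omega),
      hs _ _ n (by omega)]
    simp only [zero_add, hs1]
    field_simp
    ring
  | succ i hi ih =>
    have h1 : 1 < i + 1 := by omega
    by_cases hin : i + 1 = n - 1
    · rw [Vf_last n _ _ _ _ hin, Vf_last n _ _ _ _ hin, ih, lev_sw1 hn, lev_sw1 hn, hs _ _ _ h1,
        hs _ _ _ h1, hs _ _ _ h1, hs _ _ n (by omega)]
    · rw [Vf_succ n _ _ _ _ hin, Vf_succ n _ _ _ _ hin, ih, lev_sw1 hn, lev_sw1 hn, hs _ _ _ h1,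
        hs _ _ _ h1, hs _ _ _ h1]

/-- Solution of the recursion defining `V_i`. -/
theorem Vf_mul_prod {n : ℕ} {x xb y yb : ℕ → F} (h : CoordNeZero n x xb y yb)
    {i : ℕ} (hi : 1 ≤ i) (hin : i < n - 1) :
    Vf n x xb y yb i * ∏ j ∈ Finset.Icc 1 i, xb j / yb j
      = Vf n x xb y yb 0 + (lev n x xb - lev n y yb)
          * (stepSum xb yb x i + ∏ j ∈ Finset.Icc 1 i, xb j / yb j) := by
  induction i, hi using Nat.le_induction with
  | base =>
    have := h.x_ne 1 le_rfl (by omega)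
    have := h.xb_ne 1 le_rfl (by omega)
    have := h.yb_ne 1 le_rfl (by omega)
    rw [Vf_succ n _ _ _ _ (by omega), stepSum_one]
    simp only [zero_add, Finset.Icc_self, Finset.prod_singleton]
    field_simp
  | succ i hi ih =>
    have := h.x_ne (i + 1) (by omega) (by omega)
    have := h.xb_ne (i + 1) (by omega) (by omega)
    have := h.yb_ne (i + 1) (by omega) (by omega)
    have ih := ih (by omega)
    rw [Vf_succ n _ _ _ _ (by omega), stepSum_succ _ _ _ hi, Finset.prod_Icc_succ_top (by omega)]
    generalize (∏ j ∈ Finset.Icc 1 i, xb j / yb j) = Q at *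
    have e : Vf n x xb y yb 0 = Vf n x xb y yb i * Q
        - (lev n x xb - lev n y yb) * (stepSum xb yb x i + Q) := by
      rw [ih]; ring
    rw [e]
    field_simp
    ring

/-- Closed form of `V_{n-1}`. -/
theorem Vf_pred {n : ℕ} (hn : 4 ≤ n) {x xb y yb : ℕ → F} (h : CoordNeZero n x xb y yb) :
    Vf n x xb y yb (n - 1)
      = x n * (∏ i ∈ Finset.Icc 1 (n - 1), x i) * (∏ i ∈ Finset.Icc 1 (n - 1), yb i)
        * (stepSum y x yb (n - 1) + stepSum xb yb x (n - 1)
          + (∏ i ∈ Finset.Icc 1 (n - 1), xb i) / (∏ i ∈ Finset.Icc 1 (n - 1), yb i) / y n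
          + (∏ i ∈ Finset.Icc 1 (n - 1), y i) / (∏ i ∈ Finset.Icc 1 (n - 1), x i) * y n) := by
  have hX := prod_Icc_ne_zero (f := x) (k := n - 1) fun i h1 h2 => h.x_ne i h1 (by omega)
  have hXb := prod_Icc_ne_zero (f := xb) h.xb_ne
  have hYb := prod_Icc_ne_zero (f := yb) h.yb_ne
  have hxn := h.x_ne n (by omega) le_rfl
  have hyn := h.y_ne n (by omega) le_rfl
  have hx1 := h.x_ne (n - 1) (by omega) (by omega)
  have hxb1 := h.xb_ne (n - 1) (by omega) le_rfl
  have hyb1 := h.yb_ne (n - 1) (by omega) le_rfl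
  have hrec : Vf n x xb y yb (n - 1) * ∏ j ∈ Finset.Icc 1 (n - 1), xb j / yb j
      = Vf n x xb y yb 0 + (lev n x xb - lev n y yb)
          * (stepSum xb yb x (n - 1) + (∏ j ∈ Finset.Icc 1 (n - 1), xb j / yb j) / y n) := by
    have hm := Vf_mul_prod h (i := n - 2) (by omega) (by omega)
    obtain ⟨k, rfl⟩ : ∃ k, n = k + 2 := ⟨n - 2, by omega⟩
    have e1 : k + 2 - 1 = k + 1 := rfl
    have e2 : k + 2 - 2 = k := rfl
    rw [e1] at hx1 hxb1 hyb1 ⊢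
    rw [e2] at hm
    rw [Vf_last (k + 2) _ _ _ _ rfl, stepSum_succ _ _ _ (by omega),
      Finset.prod_Icc_succ_top (by omega)]
    generalize (∏ j ∈ Finset.Icc 1 k, xb j / yb j) = Q at *
    have e : Vf (k + 2) x xb y yb 0 = Vf (k + 2) x xb y yb k * Q
        - (lev (k + 2) x xb - lev (k + 2) y yb) * (stepSum xb yb x k + Q) := by
      rw [hm]; ring
    rw [e]
    field_simp
    ring
  rw [Finset.prod_div_distrib, Vf_zero, Finset.prod_mul_distrib, lev_eq hn, lev_eq hn] at hrec
  generalize (∏ i ∈ Finset.Icc 1 (n - 1), x i) = X at *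
  generalize (∏ i ∈ Finset.Icc 1 (n - 1), xb i) = Xb at *
  generalize (∏ i ∈ Finset.Icc 1 (n - 1), y i) = Y at *
  generalize (∏ i ∈ Finset.Icc 1 (n - 1), yb i) = Yb at *
  have hQ : Xb / Yb ≠ 0 := div_ne_zero hXb hYb
  apply mul_right_cancel₀ hQ
  rw [hrec]
  field_simp
  ring

theorem CoordNeZero.snx {n : ℕ} {x xb y yb : ℕ → F}
    (h : CoordNeZero n x xb y yb) :
    CoordNeZero n (snx n x) (snxb n x xb) (snx n y) (snxb n y yb) := by
  have key : ∀ f : ℕ → F, (∀ i, 1 ≤ i → i ≤ n → f i ≠ 0) →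
      ∀ i, 1 ≤ i → i ≤ n → _root_.snx n f i ≠ 0 := fun f hf i h1 h2 => by
    unfold _root_.snx
    split_ifs with h3 h4
    · exact mul_ne_zero (hf _ (by omega) (by omega)) (hf _ (by omega) le_rfl)
    · exact inv_ne_zero (hf _ (by omega) le_rfl)
    · exact hf i h1 h2
  have key' : ∀ f g : ℕ → F, (∀ i, 1 ≤ i → i ≤ n → f i ≠ 0) →
      (∀ i, 1 ≤ i → i ≤ n - 1 → g i ≠ 0) →
      ∀ i, 1 ≤ i → i ≤ n - 1 → snxb n f g i ≠ 0 := fun f g hf hg i h1 h2 => by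
    unfold snxb
    split_ifs with h3
    · exact mul_ne_zero (hg _ (by omega) (by omega)) (hf _ (by omega) le_rfl)
    · exact hg i h1 h2
  exact ⟨key x h.x_ne, key' x xb h.x_ne h.xb_ne, key y h.y_ne, key' y yb h.y_ne h.yb_ne⟩

/-- The transforms of `V_{n-1}` under `σ_n` and `σ✶` coincide. -/
theorem Vsn_pred {n : ℕ} (hn : 4 ≤ n) {x xb y yb : ℕ → F} (h : CoordNeZero n x xb y yb) :
    Vsn n x xb y yb (n - 1) = Vst n x xb y yb (n - 1) := by
  have hs : ∀ (f g : ℕ → F) i, 1 ≤ i → i ≤ n - 1 → stx n f g i = g i := fun f g i _ hi =>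
    if_neg (by omega)
  have hsn : ∀ f g : ℕ → F, stx n f g n = f n := fun f g => if_pos rfl
  have hp : ∀ f g : ℕ → F,
      ∏ i ∈ Finset.Icc 1 (n - 1), stx n f g i = ∏ i ∈ Finset.Icc 1 (n - 1), g i := fun f g => by
    refine Finset.prod_congr rfl fun i hi => ?_
    rw [Finset.mem_Icc] at hi
    exact hs _ _ i hi.1 hi.2
  have hX := prod_Icc_ne_zero (f := x) (k := n - 1) fun i h1 h2 => h.x_ne i h1 (by omega)
  have hYb := prod_Icc_ne_zero (f := yb) h.yb_ne
  have hxn := h.x_ne n (by omega) le_rfl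
  have hyn := h.y_ne n (by omega) le_rfl
  rw [Vsn, Vst, Vf_pred hn h.snx, Vf_pred hn (h.star hn), stepSum_snx_left hn _ _ _ hyn,
    stepSum_snx_right hn _ _ _ _ hxn, prod_snx hn, prod_snx hn, prod_snxb hn, prod_snxb hn,
    snx_self hn, snx_self hn, hsn, hsn, hp, hp,
    stepSum_congr (a := stx n x xb) (by omega) (hs _ _) (hs _ _) (fun _ _ _ => rfl),
    stepSum_congr (c := stx n y yb) (by omega) (fun _ _ _ => rfl) (fun _ _ _ => rfl) (hs _ _)]
  field_simp
  ring

/-! ### The involutions commute -/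

theorem sw1_sw1 {α : Type*} (x xb : ℕ → α) : sw1 (sw1 x xb) (sw1 xb x) = x := by
  funext i
  by_cases h : i = 1 <;> simp [sw1, h]

theorem snx_snx {n : ℕ} (hn : 4 ≤ n) (x : ℕ → F) (hx : x n ≠ 0) : snx n (snx n x) = x := by
  have h1 : n ≠ n - 1 := by omega
  funext i
  by_cases h : i = n - 1
  · simp [snx, h, h1, hx]
  · by_cases h' : i = n <;> simp [snx, h, h', h1]

theorem snxb_snxb {n : ℕ} (hn : 4 ≤ n) (x xb : ℕ → F) (hx : x n ≠ 0) :
    snxb n (snx n x) (snxb n x xb) = xb := by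
  have h1 : n ≠ n - 1 := by omega
  funext i
  by_cases h : i = n - 1 <;> simp [snx, snxb, h, h1, hx]

theorem stx_stx {α : Type*} (n : ℕ) (x xb : ℕ → α) : stx n (stx n x xb) x = x := by
  funext i
  by_cases h : i = n <;> simp [stx, h]

theorem sw1_snx {n : ℕ} (hn : 4 ≤ n) (x xb : ℕ → F) :
    sw1 (snx n x) (snxb n x xb) = snx n (sw1 x xb) := by
  funext i
  simp only [sw1, snx, snxb]
  split_ifs <;> first | omega | rfl

theorem sw1_snxb {n : ℕ} (hn : 4 ≤ n) (x xb : ℕ → F) :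
    sw1 (snxb n x xb) (snx n x) = snxb n (sw1 x xb) (sw1 xb x) := by
  funext i
  simp only [sw1, snx, snxb]
  split_ifs <;> first | omega | rfl

theorem stx_snx {n : ℕ} (hn : 4 ≤ n) (x xb : ℕ → F) :
    stx n (snx n x) (snxb n x xb) = snx n (stx n x xb) := by
  funext i
  simp only [stx, snx, snxb]
  split_ifs <;> first | omega | rfl

theorem stx_sw1 {α : Type*} {n : ℕ} (hn : 4 ≤ n) (x xb : ℕ → α) :
    stx n (sw1 x xb) (sw1 xb x) = sw1 (stx n x xb) x := by
  funext i
  simp only [stx, sw1]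
  split_ifs <;> first | omega | rfl

theorem sw1_stx {α : Type*} {n : ℕ} (hn : 4 ≤ n) (x xb : ℕ → α) :
    sw1 x (stx n x xb) = sw1 x xb := by
  funext i
  simp only [stx, sw1]
  split_ifs <;> first | omega | rfl

theorem Vs1_sw1 (n : ℕ) (x xb y yb : ℕ → F) :
    Vs1 n (sw1 x xb) (sw1 xb x) (sw1 y yb) (sw1 yb y) = Vf n x xb y yb := by
  rw [Vs1, sw1_sw1, sw1_sw1, sw1_sw1, sw1_sw1]

theorem Vst_sw1 {n : ℕ} (hn : 4 ≤ n) (x xb y yb : ℕ → F) :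
    Vst n (sw1 x xb) (sw1 xb x) (sw1 y yb) (sw1 yb y)
      = Vs1 n (stx n y yb) y (stx n x xb) x := by
  rw [Vst, Vs1, stx_sw1 hn, stx_sw1 hn, sw1_stx hn, sw1_stx hn]

theorem Vsn_sw1 {n : ℕ} (hn : 4 ≤ n) (x xb y yb : ℕ → F) :
    Vsn n (sw1 x xb) (sw1 xb x) (sw1 y yb) (sw1 yb y)
      = Vs1 n (snx n x) (snxb n x xb) (snx n y) (snxb n y yb) := by
  rw [Vsn, Vs1, sw1_snx hn, sw1_snx hn, sw1_snxb hn, sw1_snxb hn]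

theorem Vsn_snx {n : ℕ} (hn : 4 ≤ n) (x xb y yb : ℕ → F) (hx : x n ≠ 0) (hy : y n ≠ 0) :
    Vsn n (snx n x) (snxb n x xb) (snx n y) (snxb n y yb) = Vf n x xb y yb := by
  rw [Vsn, snx_snx hn _ hx, snx_snx hn _ hy, snxb_snxb hn _ _ hx, snxb_snxb hn _ _ hy]

theorem snx_eq_snxb_stx {n i : ℕ} (x xb : ℕ → F) (hi : i ≤ n - 1) (h1 : 1 ≤ i) :
    snx n x i = snxb n (stx n x xb) x i := by
  simp only [stx, snx, snxb]
  split_ifs <;> first | omega | rfl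

theorem Vst_snx {n : ℕ} (hn : 4 ≤ n) (x xb y yb : ℕ → F) {i : ℕ} (hi : i ≤ n - 1) :
    Vst n (snx n x) (snxb n x xb) (snx n y) (snxb n y yb) i
      = Vsn n (stx n y yb) y (stx n x xb) x i := by
  rw [Vst, Vsn, stx_snx hn, stx_snx hn]
  exact Vf_congr hn (fun i h1 h2 => snx_eq_snxb_stx _ _ h2 h1)
    (fun i h1 h2 => snx_eq_snxb_stx _ _ h2 h1) hi

theorem Vst_star {n : ℕ} (hn : 4 ≤ n) (x xb y yb : ℕ → F) {i : ℕ} (hi : i ≤ n - 1) :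
    Vst n (stx n y yb) y (stx n x xb) x i = Vf n x xb y yb i := by
  rw [Vst, stx_stx, stx_stx]
  exact Vf_congr hn (fun i h1 h2 => if_neg (by omega)) (fun i h1 h2 => if_neg (by omega)) hi

/-! ### Invariance of `R` -/

/-- `V_0^{σ_1}` is invariant under `σ✶`. -/
theorem Vs1_star_zero {n : ℕ} (hn : 4 ≤ n) (x xb y yb : ℕ → F) :
    Vs1 n (stx n y yb) y (stx n x xb) x 0 = Vs1 n x xb y yb 0 := by
  rw [← Vst_sw1 hn, Vst_zero hn, Vs1]

theorem Vf_snx_pred {n : ℕ} (hn : 4 ≤ n) {x xb y yb : ℕ → F} (h : CoordNeZero n x xb y yb) :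
    Vf n (snx n x) (snxb n x xb) (snx n y) (snxb n y yb) (n - 1) = Vst n x xb y yb (n - 1) :=
  Vsn_pred hn h

theorem Vst_snx_pred {n : ℕ} (hn : 4 ≤ n) {x xb y yb : ℕ → F} (h : CoordNeZero n x xb y yb) :
    Vst n (snx n x) (snxb n x xb) (snx n y) (snxb n y yb) (n - 1) = Vf n x xb y yb (n - 1) := by
  rw [Vst_snx hn _ _ _ _ le_rfl, Vsn_pred hn (h.star hn), Vst_star hn _ _ _ _ le_rfl]

theorem Vf_snx_of_lt {n : ℕ} (hn : 4 ≤ n) {x xb y yb : ℕ → F} (h : CoordNeZero n x xb y yb)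
    {i : ℕ} (hi : i < n - 1) :
    Vf n (snx n x) (snxb n x xb) (snx n y) (snxb n y yb) i = Vf n x xb y yb i :=
  Vsn_of_lt hn _ _ _ _ (h.x_ne n (by omega) le_rfl) (h.y_ne n (by omega) le_rfl) hi

theorem Vst_snx_of_lt {n : ℕ} (hn : 4 ≤ n) {x xb y yb : ℕ → F} (h : CoordNeZero n x xb y yb)
    {i : ℕ} (hi : i < n - 1) :
    Vst n (snx n x) (snxb n x xb) (snx n y) (snxb n y yb) i = Vst n x xb y yb i := by
  have h' := h.star hn
  rw [Vst_snx hn _ _ _ _ hi.le, Vsn_of_lt hn _ _ _ _ (h'.x_ne n (by omega) le_rfl)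
    (h'.y_ne n (by omega) le_rfl) hi, Vst]

theorem CoordNeZero.Vs1_of_pos {n : ℕ} (hn : 4 ≤ n) {x xb y yb : ℕ → F}
    (h : CoordNeZero n x xb y yb) {i : ℕ} (hi : 1 ≤ i) :
    Vs1 n x xb y yb i = Vf n x xb y yb i :=
  _root_.Vs1_of_pos hn _ _ _ _ (h.x_ne 1 le_rfl (by omega)) (h.xb_ne 1 le_rfl (by omega))
    (h.y_ne 1 le_rfl (by omega)) (h.yb_ne 1 le_rfl (by omega)) hi

theorem Uf_one (n : ℕ) (x xb y yb : ℕ → F) :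
    Uf n x xb y yb 1 = Vf n x xb y yb 0 * Vs1 n x xb y yb 0 :=
  if_pos rfl

theorem Uf_pred {n : ℕ} (hn : 4 ≤ n) (x xb y yb : ℕ → F) :
    Uf n x xb y yb (n - 1) = Vf n x xb y yb (n - 1) * Vst n x xb y yb (n - 1) := by
  rw [Uf, if_neg (by omega), if_pos rfl]

theorem Uf_mid {n i : ℕ} (x xb y yb : ℕ → F) (h1 : i ≠ 1) (h2 : i ≠ n - 1) :
    Uf n x xb y yb i = (1 / x i + 1 / yb i)⁻¹ *
      (Vf n x xb y yb i * Vst n x xb y yb (i - 1) / y i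
        + Vf n x xb y yb (i - 1) * Vst n x xb y yb i / xb i) := by
  rw [Uf, if_neg h1, if_neg h2]

theorem Vf_sw1_of_pos {n : ℕ} (hn : 4 ≤ n) {x xb y yb : ℕ → F} (h : CoordNeZero n x xb y yb)
    {i : ℕ} (hi : 1 ≤ i) :
    Vf n (sw1 x xb) (sw1 xb x) (sw1 y yb) (sw1 yb y) i = Vf n x xb y yb i :=
  h.Vs1_of_pos hn hi

theorem Vst_sw1_of_pos {n : ℕ} (hn : 4 ≤ n) {x xb y yb : ℕ → F} (h : CoordNeZero n x xb y yb)
    {i : ℕ} (hi : 1 ≤ i) :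
    Vst n (sw1 x xb) (sw1 xb x) (sw1 y yb) (sw1 yb y) i = Vst n x xb y yb i := by
  rw [Vst_sw1 hn, (h.star hn).Vs1_of_pos hn hi, Vst]

/-- `U_i` is invariant under `σ_1`. -/
theorem Uf_sw1 {n : ℕ} (hn : 4 ≤ n) {x xb y yb : ℕ → F} (h : CoordNeZero n x xb y yb)
    {i : ℕ} (hi : 1 ≤ i) :
    Uf n (sw1 x xb) (sw1 xb x) (sw1 y yb) (sw1 yb y) i = Uf n x xb y yb i := by
  by_cases h1 : i = 1
  · subst h1
    rw [Uf_one, Uf_one, Vs1_sw1, mul_comm, Vs1]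
  · by_cases h2 : i = n - 1
    · rw [h2, Uf_pred hn, Uf_pred hn, Vf_sw1_of_pos hn h (by omega),
        Vst_sw1_of_pos hn h (by omega)]
    · rw [Uf_mid _ _ _ _ h1 h2, Uf_mid _ _ _ _ h1 h2, Vf_sw1_of_pos hn h (by omega),
        Vst_sw1_of_pos hn h (by omega),
        Vf_sw1_of_pos hn h (by omega), Vst_sw1_of_pos hn h (by omega)]
      simp only [sw1, if_neg h1]

/-- `V_0^{σ_1}` is invariant under `σ_n`. -/
theorem Vs1_snx_zero {n : ℕ} (hn : 4 ≤ n) {x xb y yb : ℕ → F} (h : CoordNeZero n x xb y yb) :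
    Vs1 n (snx n x) (snxb n x xb) (snx n y) (snxb n y yb) 0 = Vs1 n x xb y yb 0 := by
  have hxn := h.x_ne n (by omega) le_rfl
  have hyn := h.y_ne n (by omega) le_rfl
  have hs : ∀ f g : ℕ → F, sw1 f g n = f n := fun f g => if_neg (by omega)
  rw [← Vsn_sw1 hn, Vsn_of_lt hn _ _ _ _ (by rwa [hs]) (by rwa [hs]) (by omega), Vs1]

/-- `U_i` is invariant under `σ_n`. -/
theorem Uf_snx {n : ℕ} (hn : 4 ≤ n) {x xb y yb : ℕ → F} (h : CoordNeZero n x xb y yb)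
    {i : ℕ} (hi : 1 ≤ i) (hin : i ≤ n - 1) :
    Uf n (snx n x) (snxb n x xb) (snx n y) (snxb n y yb) i = Uf n x xb y yb i := by
  by_cases h1 : i = 1
  · subst h1
    rw [Uf_one, Uf_one, Vf_snx_of_lt hn h (by omega), Vs1_snx_zero hn h]
  · by_cases h2 : i = n - 1
    · rw [h2, Uf_pred hn, Uf_pred hn, Vf_snx_pred hn h, Vst_snx_pred hn h, mul_comm]
    · have hlt : i < n - 1 := by omega
      rw [Uf_mid _ _ _ _ h1 h2, Uf_mid _ _ _ _ h1 h2, Vf_snx_of_lt hn h hlt,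
        Vst_snx_of_lt hn h hlt, Vf_snx_of_lt hn h (by omega), Vst_snx_of_lt hn h (by omega),
        snx_of_lt _ hlt, snx_of_lt _ hlt, snxb_of_lt _ _ hlt, snxb_of_lt _ _ hlt]

/-- `U_i` is invariant under `σ✶`. -/
theorem Uf_star {n : ℕ} (hn : 4 ≤ n) (x xb y yb : ℕ → F) {i : ℕ} (hi : 1 ≤ i) (hin : i ≤ n - 1) :
    Uf n (stx n y yb) y (stx n x xb) x i = Uf n x xb y yb i := by
  have hV : ∀ j, Vf n (stx n y yb) y (stx n x xb) x j = Vst n x xb y yb j := fun _ => rfl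
  by_cases h1 : i = 1
  · subst h1
    rw [Uf_one, Uf_one, hV, Vst_zero hn, Vs1_star_zero hn]
  · by_cases h2 : i = n - 1
    · rw [h2, Uf_pred hn, Uf_pred hn, hV, Vst_star hn _ _ _ _ le_rfl, mul_comm]
    · have hs : ∀ f g : ℕ → F, stx n f g i = g i := fun f g => if_neg (by omega)
      rw [Uf_mid _ _ _ _ h1 h2, Uf_mid _ _ _ _ h1 h2, hV, hV, Vst_star hn _ _ _ _ hin,
        Vst_star hn _ _ _ _ (by omega), hs, hs]
      ring

/-- `R` commutes with `σ_1`. -/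
theorem R_sw1 {n : ℕ} (hn : 4 ≤ n) {x xb y yb : ℕ → F} (h : CoordNeZero n x xb y yb) :
    (∀ i, 1 ≤ i → Rx n (sw1 x xb) (sw1 xb x) (sw1 y yb) (sw1 yb y) i
      = sw1 (Rx n x xb y yb) (Rxb n x xb y yb) i) ∧
    (∀ i, 1 ≤ i → Rxb n (sw1 x xb) (sw1 xb x) (sw1 y yb) (sw1 yb y) i
      = sw1 (Rxb n x xb y yb) (Rx n x xb y yb) i) ∧
    (∀ i, 1 ≤ i → Ry n (sw1 x xb) (sw1 xb x) (sw1 y yb) (sw1 yb y) i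
      = sw1 (Ry n x xb y yb) (Ryb n x xb y yb) i) ∧
    (∀ i, 1 ≤ i → Ryb n (sw1 x xb) (sw1 xb x) (sw1 y yb) (sw1 yb y) i
      = sw1 (Ryb n x xb y yb) (Ry n x xb y yb) i) := by
  have hs : ∀ (f g : ℕ → F) i, i ≠ 1 → sw1 f g i = f i := fun f g i hi => if_neg hi
  have hs1 : ∀ (f g : ℕ → F), sw1 f g 1 = g 1 := fun f g => if_pos rfl
  have hV0 : Vf n (sw1 x xb) (sw1 xb x) (sw1 y yb) (sw1 yb y) 0 = Vs1 n x xb y yb 0 := rfl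
  have hVsn : Vsn n (sw1 x xb) (sw1 xb x) (sw1 y yb) (sw1 yb y) (n - 1)
      = Vsn n x xb y yb (n - 1) := by
    rw [Vsn_sw1 hn, h.snx.Vs1_of_pos hn (by omega), Vsn]
  have hV := @Vf_sw1_of_pos F _ n hn x xb y yb h
  have hVst := @Vst_sw1_of_pos F _ n hn x xb y yb h
  have hU := @Uf_sw1 F _ n hn x xb y yb h
  refine ⟨fun i hi => ?_, fun i hi => ?_, fun i hi => ?_, fun i hi => ?_⟩
  all_goals
    by_cases h1 : i = 1
    · subst h1
      simp only [hs1, Rx, Rxb, Ry, Ryb, if_true, Vs1_sw1, hV0, hV le_rfl, hVst le_rfl]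
    · have hi1 : 1 ≤ i - 1 := by omega
      have hn1 : 1 ≤ n - 1 := by omega
      have hn' : n ≠ 1 := by omega
      simp only [hs _ _ i h1, hs _ _ n hn', Rx, Rxb, Ry, Ryb, if_neg h1, hV hi, hV hi1, hVst hi,
        hVst hi1, hU hi, hU hi1, hV hn1, hVsn]

/-- `R` commutes with `σ_n`. -/
theorem R_snx {n : ℕ} (hn : 4 ≤ n) {x xb y yb : ℕ → F} (h : CoordNeZero n x xb y yb)
    (hadm : Adm n x xb y yb) :
    (∀ i, 1 ≤ i → i ≤ n → Rx n (snx n x) (snxb n x xb) (snx n y) (snxb n y yb) i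
      = snx n (Rx n x xb y yb) i) ∧
    (∀ i, 1 ≤ i → i ≤ n - 1 → Rxb n (snx n x) (snxb n x xb) (snx n y) (snxb n y yb) i
      = snxb n (Rx n x xb y yb) (Rxb n x xb y yb) i) ∧
    (∀ i, 1 ≤ i → i ≤ n → Ry n (snx n x) (snxb n x xb) (snx n y) (snxb n y yb) i
      = snx n (Ry n x xb y yb) i) ∧
    (∀ i, 1 ≤ i → i ≤ n - 1 → Ryb n (snx n x) (snxb n x xb) (snx n y) (snxb n y yb) i
      = snxb n (Ry n x xb y yb) (Ryb n x xb y yb) i) := by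
  have hxn := h.x_ne n (by omega) le_rfl
  have hyn := h.y_ne n (by omega) le_rfl
  have hV := @Vf_snx_of_lt F _ n hn x xb y yb h
  have hVst := @Vst_snx_of_lt F _ n hn x xb y yb h
  have hVp := Vf_snx_pred hn h
  have hVstp := Vst_snx_pred hn h
  have hU := @Uf_snx F _ n hn x xb y yb h
  have hVs1 := Vs1_snx_zero hn h
  have hVsn := Vsn_snx hn x xb y yb hxn hyn
  have hVp_ne := hadm.1 (n - 1) le_rfl
  have hVstp_ne := hadm.2.1 (n - 1) le_rfl
  have hp := Vsn_pred hn h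
  have n1 : n - 1 ≠ 1 := by omega
  have n2 : n - 1 ≠ n := by omega
  have n3 : n ≠ 1 := by omega
  have l1 : n - 1 - 1 < n - 1 := by omega
  have l2 : 1 ≤ n - 1 - 1 := by omega
  have l3 : 1 ≤ n - 1 := by omega
  have l4 : 1 < n - 1 := by omega
  have l5 : 0 < n - 1 := by omega
  refine ⟨fun i hi hin => ?_, fun i hi hin => ?_, fun i hi hin => ?_, fun i hi hin => ?_⟩
  all_goals
    by_cases h1 : i = 1
    · subst h1
      simp only [snx_of_lt _ l4, snxb_of_lt _ _ l4, Rx, Rxb, Ry, Ryb, if_true, hV l4, hVst l4,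
        hV l5, hVs1]
    by_cases h2 : i = n - 1
    · subst h2
      simp only [snx_pred, snxb_pred, Rx, Rxb, Ry, Ryb, if_neg n1, if_neg n2, if_neg n3, if_true,
        hV l1, hVst l1, hVp, hVstp, hU l3 le_rfl, hU l2 l1.le, hp]
      field_simp
    by_cases h3 : i = n
    · first
      | omega
      | subst h3
        simp only [snx_self hn, Rx, Ry, if_neg n3, if_true, hVsn, hVp, hp, mul_inv,
          div_eq_mul_inv, inv_inv]
        ring
    have hlt : i < n - 1 := by omega
    have hlt' : i - 1 < n - 1 := by omega
    have hi' : 1 ≤ i - 1 := by omega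
    simp only [snx_of_lt _ hlt, snxb_of_lt _ _ hlt, Rx, Rxb, Ry, Ryb, if_neg h1, if_neg h3, hV hlt,
      hV hlt', hVst hlt, hVst hlt', hU hi hlt.le, hU hi' hlt'.le]

/-- `R` commutes with `σ✶`. -/
theorem R_star {n : ℕ} (hn : 4 ≤ n) {x xb y yb : ℕ → F} (h : CoordNeZero n x xb y yb) :
    (∀ i, 1 ≤ i → i ≤ n → Rx n (stx n y yb) y (stx n x xb) x i
      = stx n (Ry n x xb y yb) (Ryb n x xb y yb) i) ∧
    (∀ i, 1 ≤ i → i ≤ n - 1 → Rxb n (stx n y yb) y (stx n x xb) x i = Ry n x xb y yb i) ∧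
    (∀ i, 1 ≤ i → i ≤ n → Ry n (stx n y yb) y (stx n x xb) x i
      = stx n (Rx n x xb y yb) (Rxb n x xb y yb) i) ∧
    (∀ i, 1 ≤ i → i ≤ n - 1 → Ryb n (stx n y yb) y (stx n x xb) x i = Rx n x xb y yb i) := by
  have hs : ∀ (f g : ℕ → F) i, i ≠ n → stx n f g i = g i := fun f g i hi => if_neg hi
  have hsn : ∀ (f g : ℕ → F), stx n f g n = f n := fun f g => if_pos rfl
  have hV : ∀ j, Vf n (stx n y yb) y (stx n x xb) x j = Vst n x xb y yb j := fun _ => rfl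
  have hVst := @Vst_star F _ n hn x xb y yb
  have hVsn : Vsn n (stx n y yb) y (stx n x xb) x (n - 1) = Vf n x xb y yb (n - 1) := by
    rw [Vsn_pred hn (h.star hn), hVst le_rfl]
  have hp := Vsn_pred hn h
  have hU := @Uf_star F _ n hn x xb y yb
  have n3 : n ≠ 1 := by omega
  refine ⟨fun i hi hin => ?_, fun i hi hin => ?_, fun i hi hin => ?_, fun i hi hin => ?_⟩
  all_goals
    by_cases h1 : i = 1
    · subst h1
      have l3 : 1 ≤ n - 1 := by omega
      simp only [hs _ _ 1 n3.symm, Rx, Rxb, Ry, Ryb, if_true, hV, hVst l3, Vst_zero hn,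
        Vs1_star_zero hn]
    by_cases h3 : i = n
    · first
      | omega
      | subst h3
        simp only [hsn, Rx, Ry, if_neg n3, if_true, hV, hVsn, hp]
    have hle : i ≤ n - 1 := by omega
    have hle' : i - 1 ≤ n - 1 := by omega
    have hi' : 1 ≤ i - 1 := by omega
    simp only [hs _ _ i h3, Rx, Rxb, Ry, Ryb, if_neg h1, if_neg h3, hV, hVst hle, hVst hle',
      hU hi hle, hU hi' hle']

end TropicalR

theorem stmt15 {F : Type*} [Field F] (n : ℕ) (hn : 4 ≤ n)
    (x xb y yb : ℕ → F)
    (hx : ∀ i, 1 ≤ i → i ≤ n → x i ≠ 0) (hxb : ∀ i, 1 ≤ i → i ≤ n - 1 → xb i ≠ 0)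
    (hy : ∀ i, 1 ≤ i → i ≤ n → y i ≠ 0) (hyb : ∀ i, 1 ≤ i → i ≤ n - 1 → yb i ≠ 0)
    (hadm : Adm n x xb y yb) :
    -- commutation with σ_1
    (Adm n (sw1 x xb) (sw1 xb x) (sw1 y yb) (sw1 yb y) →
      (∀ i, 1 ≤ i → i ≤ n →
        Rx n (sw1 x xb) (sw1 xb x) (sw1 y yb) (sw1 yb y) i
          = sw1 (Rx n x xb y yb) (Rxb n x xb y yb) i) ∧
      (∀ i, 1 ≤ i → i ≤ n - 1 →
        Rxb n (sw1 x xb) (sw1 xb x) (sw1 y yb) (sw1 yb y) i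
          = sw1 (Rxb n x xb y yb) (Rx n x xb y yb) i) ∧
      (∀ i, 1 ≤ i → i ≤ n →
        Ry n (sw1 x xb) (sw1 xb x) (sw1 y yb) (sw1 yb y) i
          = sw1 (Ry n x xb y yb) (Ryb n x xb y yb) i) ∧
      (∀ i, 1 ≤ i → i ≤ n - 1 →
        Ryb n (sw1 x xb) (sw1 xb x) (sw1 y yb) (sw1 yb y) i
          = sw1 (Ryb n x xb y yb) (Ry n x xb y yb) i)) ∧
    -- commutation with σ_n
    (Adm n (snx n x) (snxb n x xb) (snx n y) (snxb n y yb) →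
      (∀ i, 1 ≤ i → i ≤ n →
        Rx n (snx n x) (snxb n x xb) (snx n y) (snxb n y yb) i
          = snx n (Rx n x xb y yb) i) ∧
      (∀ i, 1 ≤ i → i ≤ n - 1 →
        Rxb n (snx n x) (snxb n x xb) (snx n y) (snxb n y yb) i
          = snxb n (Rx n x xb y yb) (Rxb n x xb y yb) i) ∧
      (∀ i, 1 ≤ i → i ≤ n →
        Ry n (snx n x) (snxb n x xb) (snx n y) (snxb n y yb) i
          = snx n (Ry n x xb y yb) i) ∧
      (∀ i, 1 ≤ i → i ≤ n - 1 →
        Ryb n (snx n x) (snxb n x xb) (snx n y) (snxb n y yb) i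
          = snxb n (Ry n x xb y yb) (Ryb n x xb y yb) i)) ∧
    -- commutation with σ✶
    (Adm n (stx n y yb) y (stx n x xb) x →
      (∀ i, 1 ≤ i → i ≤ n →
        Rx n (stx n y yb) y (stx n x xb) x i
          = stx n (Ry n x xb y yb) (Ryb n x xb y yb) i) ∧
      (∀ i, 1 ≤ i → i ≤ n - 1 →
        Rxb n (stx n y yb) y (stx n x xb) x i = Ry n x xb y yb i) ∧
      (∀ i, 1 ≤ i → i ≤ n →
        Ry n (stx n y yb) y (stx n x xb) x i
          = stx n (Rx n x xb y yb) (Rxb n x xb y yb) i) ∧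
      (∀ i, 1 ≤ i → i ≤ n - 1 →
        Ryb n (stx n y yb) y (stx n x xb) x i = Rx n x xb y yb i)) := by
  have h : CoordNeZero n x xb y yb := ⟨hx, hxb, hy, hyb⟩
  obtain ⟨h1, h2, h3, h4⟩ := R_sw1 hn h
  exact ⟨fun _ => ⟨fun i hi _ => h1 i hi, fun i hi _ => h2 i hi, fun i hi _ => h3 i hi,
    fun i hi _ => h4 i hi⟩, fun _ => R_snx hn h hadm, fun _ => R_star hn h⟩
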